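/- If positive integers n1 ≥ n2 ≥ n3 ≥ n4 and a satisfy F_{n1} + F_{n2} + F_{n3} + F_{n4} = 2^a with n1 > 350 and n1 − n2 = 2, then n1 − n3 < 296. -/

import Mathlib

namespace FibPow

/-- Forces evaluation of a natural number before passing it on. -/
def strict {β : Type} (n : ℕ) (f : ℕ → β) : β :=
  match n with
  | 0 => f 0
  | Nat.succ k => f (Nat.succ k)

theorem strict_eq {β : Type} (n : ℕ) (f : ℕ → β) : strict n f = f n := by
  cases n <;> rfl

/-- Fibonacci pair modulo `W` by doubling, in continuation passing style. -/
def fp (W : ℕ) : ℕ → ℕ → (ℕ → ℕ → Bool) → Bool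
  | 0, _, k => k 0 1
  | Nat.succ f, n, k => strict (Nat.div n 2) fun h => fp W f h fun a b =>
      strict (Nat.mod (Nat.mul a (Nat.add (Nat.mul 2 b) (Nat.mul (Nat.sub W 1) a))) W) fun c =>
      strict (Nat.mod (Nat.add (Nat.mul a a) (Nat.mul b b)) W) fun d =>
      match Nat.mod n 2 with
      | 0 => k c d
      | Nat.succ _ => strict (Nat.mod (Nat.add c d) W) fun e => k d e

theorem double_aux (W n : ℕ) (hW : 1 < W) :
    (Nat.fib n % W * (2 * (Nat.fib (n + 1) % W) + (W - 1) * (Nat.fib n % W))) % W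
      = Nat.fib (2 * n) % W := by
  have h1 : Nat.fib n ≤ 2 * Nat.fib (n + 1) :=
    (Nat.fib_le_fib_succ).trans (by omega)
  obtain ⟨V, rfl⟩ : ∃ V, W = V + 1 := ⟨W - 1, by omega⟩
  have e : Nat.fib n * (2 * Nat.fib (n + 1) + V * Nat.fib n)
      = Nat.fib (2 * n) + (V + 1) * (Nat.fib n * Nat.fib n) := by
    rw [Nat.fib_two_mul]
    zify [h1]
    ring
  have : Nat.fib n * (2 * Nat.fib (n + 1) + V * Nat.fib n) ≡ Nat.fib (2 * n) [MOD (V + 1)] := by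
    rw [e]; unfold Nat.ModEq; simp
  refine Eq.trans ?_ this
  simp only [Nat.add_sub_cancel]
  exact Nat.ModEq.mul (Nat.mod_modEq _ _)
    (Nat.ModEq.add (Nat.ModEq.mul_left _ (Nat.mod_modEq _ _))
      (Nat.ModEq.mul_left _ (Nat.mod_modEq _ _)))

theorem double_aux2 (W n : ℕ) :
    (Nat.fib n % W * (Nat.fib n % W) + Nat.fib (n + 1) % W * (Nat.fib (n + 1) % W)) % W
      = Nat.fib (2 * n + 1) % W := by
  rw [Nat.fib_two_mul_add_one, add_comm (Nat.fib (n + 1) ^ 2), sq, sq]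
  exact Nat.ModEq.add (Nat.ModEq.mul (Nat.mod_modEq _ _) (Nat.mod_modEq _ _))
    (Nat.ModEq.mul (Nat.mod_modEq _ _) (Nat.mod_modEq _ _))

theorem fp_eq (W : ℕ) (hW : 1 < W) (f : ℕ) : ∀ (n : ℕ) (k : ℕ → ℕ → Bool), n < 2 ^ f →
    fp W f n k = k (Nat.fib n % W) (Nat.fib (n + 1) % W) := by
  induction f with
  | zero =>
    intro n k hn
    obtain rfl : n = 0 := by simpa using hn
    simp [fp, Nat.mod_eq_of_lt hW]
  | succ f ih =>
    intro n k hn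
    have hh : n / 2 < 2 ^ f := by rw [pow_succ] at hn; omega
    have hd : n.div 2 = n / 2 := rfl
    have hm : n.mod 2 = n % 2 := rfl
    unfold fp
    simp only [strict_eq]
    rw [hd, ih _ _ hh]
    have a1 := double_aux W (n / 2) hW
    have a2 := double_aux2 W (n / 2)
    change (match n % 2 with
      | 0 => k ((Nat.fib (n / 2) % W * (2 * (Nat.fib (n / 2 + 1) % W) + (W - 1) * (Nat.fib (n / 2) % W))) % W)
          ((Nat.fib (n / 2) % W * (Nat.fib (n / 2) % W) + Nat.fib (n / 2 + 1) % W * (Nat.fib (n / 2 + 1) % W)) % W)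
      | Nat.succ _ => k ((Nat.fib (n / 2) % W * (Nat.fib (n / 2) % W) + Nat.fib (n / 2 + 1) % W * (Nat.fib (n / 2 + 1) % W)) % W)
          (((Nat.fib (n / 2) % W * (2 * (Nat.fib (n / 2 + 1) % W) + (W - 1) * (Nat.fib (n / 2) % W))) % W +
          ((Nat.fib (n / 2) % W * (Nat.fib (n / 2) % W) + Nat.fib (n / 2 + 1) % W * (Nat.fib (n / 2 + 1) % W)) % W)) % W)) = _
    rw [a1, a2]
    rcases Nat.mod_two_eq_zero_or_one n with h | h
    · rw [h]
      have : 2 * (n / 2) = n := by omega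
      simp only [this]
    · rw [h]
      have e : 2 * (n / 2) + 1 = n := by omega
      have e2 : n + 1 = 2 * (n / 2) + 2 := by omega
      have : (Nat.fib (2 * (n / 2)) % W + Nat.fib (2 * (n / 2) + 1) % W) % W
          = Nat.fib (n + 1) % W := by
        rw [e2, Nat.fib_add_two]; simp
      simp only [this]
      rw [e]

/-- Necessary conditions for `v` to be a large power of two. -/
noncomputable def tests (v : ℕ) (l : List (ℕ × ℕ × ℕ)) : Bool :=
  List.rec (motive := fun _ => Bool) true (fun x _ ih =>
    Bool.rec (motive := fun _ => Bool) false ih (Nat.beq (Nat.mod (Nat.pow (Nat.mod v x.1) x.2.1) x.1) x.2.2)) l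

theorem tests_cons (v p M r : ℕ) (l : List (ℕ × ℕ × ℕ)) : tests v ((p, M, r) :: l) =
    (Nat.beq (Nat.mod (Nat.pow (Nat.mod v p) M) p) r && tests v l) := by
  change Bool.rec (motive := fun _ => Bool) false (tests v l) (Nat.beq (Nat.mod (Nat.pow (Nat.mod v p) M) p) r) = _
  cases (Nat.beq (Nat.mod (Nat.pow (Nat.mod v p) M) p) r) <;> rfl

/-- `List.all` through the recursor, for faster kernel evaluation. -/
noncomputable def allL (f : ℕ × ℕ → Bool) (l : List (ℕ × ℕ)) : Bool :=
  List.rec (motive := fun _ => Bool) true (fun x _ ih => Bool.rec (motive := fun _ => Bool) false ih (f x)) l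

theorem allL_mem (f : ℕ × ℕ → Bool) (l : List (ℕ × ℕ)) (h : allL f l = true)
    (x : ℕ × ℕ) (hx : x ∈ l) : f x = true := by
  induction l with
  | nil => simp at hx
  | cons y l ih =>
    change Bool.rec (motive := fun _ => Bool) false (allL f l) (f y) = true at h
    cases hy : f y with
    | false => rw [hy] at h; cases h
    | true =>
      rw [hy] at h
      rcases List.mem_cons.mp hx with rfl | hx
      · exact hy
      · exact ih h hx

/-- All lifts of a residue class, given by pairs of Fibonacci values. -/
noncomputable def lifts (W c d e : ℕ) (q : ℕ) :
    ℕ → ℕ → List (ℕ × ℕ) → (List (ℕ × ℕ) → Bool) → Bool :=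
  Nat.rec (motive := fun _ => ℕ → ℕ → List (ℕ × ℕ) → (List (ℕ × ℕ) → Bool) → Bool)
    (fun _ _ acc k => k acc)
    (fun _ ih a b acc k =>
      strict (Nat.mod (Nat.add (Nat.mul a e) (Nat.mul b c)) W) fun a' =>
      strict (Nat.mod (Nat.add (Nat.mul a c) (Nat.mul b d)) W) fun b' =>
      ih a' b' ((a, b) :: acc) k) q

/-- A sieving stage: multiplier `q`, the shift `(c, d, e)`, modulus, tests. -/
abbrev Stage := ℕ × (ℕ × ℕ × ℕ) × ℕ × List (ℕ × ℕ × ℕ)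

/-- The sieve. -/
noncomputable def chk (W : ℕ) (st : List Stage) : ℕ × ℕ → ℕ × ℕ → ℕ × ℕ → Bool :=
  List.rec (motive := fun _ => ℕ × ℕ → ℕ × ℕ → ℕ × ℕ → Bool)
    (fun _ _ _ => false) (fun S _ ih m s t =>
    lifts W S.2.1.1 S.2.1.2.1 S.2.1.2.2 S.1 m.1 m.2 [] fun LA =>
    lifts W S.2.1.1 S.2.1.2.1 S.2.1.2.2 S.1 s.1 s.2 [] fun LB =>
    lifts W S.2.1.1 S.2.1.2.1 S.2.1.2.2 S.1 t.1 t.2 [] fun LC =>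
    allL (fun x => allL (fun y =>
    strict (Nat.add (Nat.add (Nat.mul 2 x.1) x.2) y.1) fun w =>
    allL (fun z => Bool.rec (motive := fun _ => Bool) true (ih x y z)
      (tests (Nat.add w z.1) S.2.2.2)) LC) LB) LA) st

theorem chk_cons (W : ℕ) (S : Stage) (st : List Stage) (m s t : ℕ × ℕ) :
    chk W (S :: st) m s t =
    lifts W S.2.1.1 S.2.1.2.1 S.2.1.2.2 S.1 m.1 m.2 [] fun LA =>
    lifts W S.2.1.1 S.2.1.2.1 S.2.1.2.2 S.1 s.1 s.2 [] fun LB =>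
    lifts W S.2.1.1 S.2.1.2.1 S.2.1.2.2 S.1 t.1 t.2 [] fun LC =>
    allL (fun x => allL (fun y =>
    strict (Nat.add (Nat.add (Nat.mul 2 x.1) x.2) y.1) fun w =>
    allL (fun z => Bool.rec (motive := fun _ => Bool) true (chk W st x y z)
      (tests (Nat.add w z.1) S.2.2.2)) LC) LB) LA := rfl

/-- Validity of one test. -/
def validT (W : ℕ) (x : ℕ × ℕ × ℕ) : Bool :=
  Nat.beq (W % x.1) 0 &&
  ((Nat.beq x.2.2 1 && Nat.beq (2 ^ x.2.1 % x.1) 1 && Nat.ble 2 x.1) ||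
   (Nat.beq x.2.2 0 && Nat.beq x.2.1 1 && Nat.beq (2048 % x.1) 0))

/-- Validity of the stages. -/
def valid (W : ℕ) : List Stage → ℕ → Bool
  | [], _ => true
  | (q, (c, d, e), V, ts) :: rest, N =>
    Nat.ble 2 V && Nat.ble 1 q && Nat.ble (N * q + 1) (2 ^ 14) && Nat.beq (W % V) 0 &&
    (fp W 14 (N - 1) fun a b => Nat.beq a e && Nat.beq b c) &&
    (fp W 14 N fun _ b => Nat.beq b d) &&
    (fp V 14 (N * q) fun a b => Nat.beq a 0 && Nat.beq b 1) &&
    ts.all (validT V) && valid W rest (N * q)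

theorem tests_true (W v a : ℕ) (ha : 11 ≤ a) (ts : List (ℕ × ℕ × ℕ))
    (hts : ∀ x ∈ ts, validT W x = true) (hv : v ≡ 2 ^ a [MOD W]) : tests v ts = true := by
  induction ts with
  | nil => rfl
  | cons x l ih =>
    obtain ⟨p, M, r⟩ := x
    have hx := hts (p, M, r) (by simp)
    have ih' := ih (fun x hx => hts x (by simp [hx]))
    simp only [tests_cons, ih', Bool.and_true]
    simp only [validT, Bool.and_eq_true, Bool.or_eq_true, Nat.beq_eq, Nat.ble_eq] at hx
    obtain ⟨hp, hx⟩ := hx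
    have hv' : v ≡ 2 ^ a [MOD p] := hv.of_dvd (Nat.dvd_of_mod_eq_zero hp)
    rw [Nat.beq_eq]
    change (v % p) ^ M % p = r
    have h1 : (v % p) ^ M ≡ (2 ^ a) ^ M [MOD p] := ((Nat.mod_modEq v p).trans hv').pow M
    rw [h1]
    rcases hx with ⟨⟨hr, hM⟩, h2⟩ | ⟨⟨hr, hM⟩, h2⟩
    · subst hr
      rw [← pow_mul, mul_comm, pow_mul]
      have : 2 ^ M ≡ 1 [MOD p] := by
        unfold Nat.ModEq; rw [hM, Nat.mod_eq_of_lt (by omega)]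
      have h3 := this.pow a
      rw [h3, one_pow, Nat.mod_eq_of_lt (by omega)]
    · subst hr hM
      rw [pow_one]
      apply Nat.mod_eq_zero_of_dvd
      have : p ∣ 2 ^ 11 := Nat.dvd_of_mod_eq_zero h2
      exact this.trans (pow_dvd_pow 2 ha)

theorem lifts_spec (W N c d e : ℕ) (hN : 0 < N) (hc : Nat.fib N % W = c)
    (hd : Nat.fib (N + 1) % W = d) (he : Nat.fib (N - 1) % W = e) (q : ℕ) :
    ∀ (n : ℕ) (acc : List (ℕ × ℕ)) (k : List (ℕ × ℕ) → Bool),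
    lifts W c d e q (Nat.fib n % W) (Nat.fib (n + 1) % W) acc k = true →
    ∃ L, k L = true ∧ (∀ x ∈ acc, x ∈ L) ∧
      ∀ i < q, (Nat.fib (n + N * i) % W, Nat.fib (n + N * i + 1) % W) ∈ L := by
  induction q with
  | zero =>
    intro n acc k h
    exact ⟨acc, h, fun x hx => hx, by simp⟩
  | succ q ih =>
    intro n acc k h
    change strict ((Nat.fib n % W * e + Nat.fib (n + 1) % W * c) % W) (fun a' =>
      strict ((Nat.fib n % W * c + Nat.fib (n + 1) % W * d) % W) fun b' =>
      lifts W c d e q a' b' ((Nat.fib n % W, Nat.fib (n + 1) % W) :: acc) k) = true at h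
    rw [strict_eq, strict_eq] at h
    have e1 : (Nat.fib n % W * e + Nat.fib (n + 1) % W * c) % W = Nat.fib (n + N) % W := by
      obtain ⟨M, rfl⟩ : ∃ M, N = M + 1 := ⟨N - 1, by omega⟩
      rw [← hc, ← he, ← add_assoc, Nat.fib_add]
      exact Nat.ModEq.add (Nat.ModEq.mul (Nat.mod_modEq _ _) (Nat.mod_modEq _ _))
        (Nat.ModEq.mul (Nat.mod_modEq _ _) (Nat.mod_modEq _ _))
    have e2 : (Nat.fib n % W * c + Nat.fib (n + 1) % W * d) % W = Nat.fib (n + N + 1) % W := by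
      rw [← hc, ← hd, Nat.fib_add]
      exact Nat.ModEq.add (Nat.ModEq.mul (Nat.mod_modEq _ _) (Nat.mod_modEq _ _))
        (Nat.ModEq.mul (Nat.mod_modEq _ _) (Nat.mod_modEq _ _))
    rw [e1, e2] at h
    obtain ⟨L, h1, h2, h3⟩ := ih _ _ _ h
    refine ⟨L, h1, fun x hx => h2 x (by simp [hx]), fun i hi => ?_⟩
    cases i with
    | zero => exact h2 _ (by simp)
    | succ i =>
      have := h3 i (by omega)
      rw [show n + N * (i + 1) = n + N + N * i by ring]
      exact this

theorem fib_period (W N : ℕ) (h0 : Nat.fib N % W = 0) (h1 : Nat.fib (N + 1) % W = 1)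
    (n : ℕ) : Nat.fib (n + N) ≡ Nat.fib n [MOD W] := by
  have h1' : Nat.fib (N + 1) ≡ 1 [MOD W] := by
    have h2 := congrArg (· % W) h1
    simp only [Nat.mod_mod] at h2
    exact h2
  have h0' : Nat.fib N ≡ 0 [MOD W] := by
    unfold Nat.ModEq
    rw [h0, Nat.zero_mod]
  induction n using Nat.strong_induction_on with
  | _ n ih =>
    match n with
    | 0 => simpa using h0'
    | 1 => simpa [add_comm] using h1'
    | n + 2 =>
      have e : n + 2 + N = (n + N) + 2 := by ring
      rw [e, Nat.fib_add_two, Nat.fib_add_two]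
      have := ih (n + 1) (by omega)
      rw [show n + 1 + N = n + N + 1 by ring] at this
      exact (ih n (by omega)).add this

theorem fib_mod (W N : ℕ) (h0 : Nat.fib N % W = 0) (h1 : Nat.fib (N + 1) % W = 1)
    (n : ℕ) : Nat.fib (n % N) ≡ Nat.fib n [MOD W] ∧
      Nat.fib (n % N + 1) ≡ Nat.fib (n + 1) [MOD W] := by
  have key : ∀ c r : ℕ, Nat.fib (r + N * c) ≡ Nat.fib r [MOD W] := by
    intro c
    induction c with
    | zero => intro r; exact Nat.ModEq.refl _
    | succ c ih =>
      intro r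
      rw [show r + N * (c + 1) = (r + N * c) + N by ring]
      exact (fib_period W N h0 h1 _).trans (ih r)
  have e := Nat.mod_add_div n N
  constructor
  · have := key (n / N) (n % N)
    rw [e] at this
    exact this.symm
  · have := key (n / N) (n % N + 1)
    rw [show n % N + 1 + N * (n / N) = n + 1 by omega] at this
    exact this.symm

theorem sound (W m s t a : ℕ) (hW : 1 < W) (ha : 11 ≤ a)
    (h : Nat.fib (m + 2) + Nat.fib m + Nat.fib s + Nat.fib t = 2 ^ a)
    (st : List Stage) : ∀ N : ℕ, 0 < N → valid W st N = true →
    chk W st (Nat.fib (m % N) % W, Nat.fib (m % N + 1) % W)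
      (Nat.fib (s % N) % W, Nat.fib (s % N + 1) % W)
      (Nat.fib (t % N) % W, Nat.fib (t % N + 1) % W) = true → False := by
  induction st with
  | nil => intro N _ _ hc; cases hc
  | cons x rest ih =>
    obtain ⟨q, ⟨c, d, e⟩, V, ts⟩ := x
    intro N hN hv hc
    simp only [valid, Bool.and_eq_true, Nat.ble_eq, List.all_eq_true] at hv
    obtain ⟨⟨⟨⟨⟨⟨⟨⟨hV, hq⟩, hb⟩, hVW⟩, g1⟩, g2⟩, hf⟩, hts⟩, hrest⟩ := hv
    rw [Nat.beq_eq] at hVW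
    have hVW : V ∣ W := Nat.dvd_of_mod_eq_zero hVW
    have hNq : N * 1 ≤ N * q := Nat.mul_le_mul_left _ hq
    rw [fp_eq V hV 14 _ _ (by omega)] at hf
    rw [fp_eq W hW 14 _ _ (by omega)] at g1
    rw [fp_eq W hW 14 _ _ (by omega)] at g2
    simp only [Bool.and_eq_true, Nat.beq_eq] at hf g1 g2
    obtain ⟨f0, f1⟩ := hf
    obtain ⟨he, hcc⟩ := g1
    rw [Nat.sub_add_cancel hN] at hcc
    have idx : ∀ n, n % N + N * (n / N % q) = n % (N * q) := fun n => (Nat.mod_mul).symm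
    have hlt : ∀ n, n / N % q < q := fun n => Nat.mod_lt _ (by omega)
    rw [chk_cons] at hc
    obtain ⟨LA, hc, -, hA⟩ := lifts_spec W N c d e hN hcc g2 he q _ _ _ hc
    obtain ⟨LB, hc, -, hB⟩ := lifts_spec W N c d e hN hcc g2 he q _ _ _ hc
    obtain ⟨LC, hc, -, hC⟩ := lifts_spec W N c d e hN hcc g2 he q _ _ _ hc
    have hA := hA _ (hlt m)
    have hB := hB _ (hlt s)
    have hC := hC _ (hlt t)
    rw [idx] at hA hB hC
    simp only [strict_eq] at hc
    have hc := allL_mem _ _ hc _ hA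
    have hc := allL_mem _ _ hc _ hB
    have hc := allL_mem _ _ hc _ hC
    have hmm : ∀ x : ℕ, x % W ≡ x [MOD V] := fun x => (Nat.mod_modEq x W).of_dvd hVW
    have hvv : 2 * (Nat.fib (m % (N * q)) % W) + Nat.fib (m % (N * q) + 1) % W
        + Nat.fib (s % (N * q)) % W + Nat.fib (t % (N * q)) % W ≡ 2 ^ a [MOD V] := by
      rw [← h, Nat.fib_add_two,
        show Nat.fib m + Nat.fib (m + 1) + Nat.fib m = 2 * Nat.fib m + Nat.fib (m + 1) by ring]
      obtain ⟨m1, m2⟩ := fib_mod V (N * q) f0 f1 m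
      have s1 := (fib_mod V (N * q) f0 f1 s).1
      have t1 := (fib_mod V (N * q) f0 f1 t).1
      exact ((((hmm _).trans m1).mul_left 2).add ((hmm _).trans m2)
        |>.add ((hmm _).trans s1)).add ((hmm _).trans t1)
    have ht := tests_true V _ a ha ts hts hvv
    refine ih (N * q) (Nat.mul_pos hN (by omega)) hrest ?_
    refine Eq.trans ?_ hc
    change _ = Bool.rec (motive := fun _ => Bool) true _
      (tests (2 * (Nat.fib (m % (N * q)) % W) + Nat.fib (m % (N * q) + 1) % W
        + Nat.fib (s % (N * q)) % W + Nat.fib (t % (N * q)) % W) ts)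
    rw [ht]

/-- The total modulus. -/
def modulus : ℕ := 16665091624589795700497782144519289695184389678508520718768581229548201984

/-- The sieving data. -/
def stages : List Stage :=
  [(3, (1, 1, 0), 2, [(2, 1, 0)]),
   (2, (2, 3, 1), 4, [(4, 1, 0)]),
   (2, (8, 13, 5), 8, [(8, 1, 0)]),
   (2, (144, 233, 89), 48, [(16, 1, 0), (3, 2, 1)]),
   (2, (46368, 75025, 28657), 5152, [(32, 1, 0), (7, 3, 1), (23, 11, 1)]),
   (5, (4807526976, 7778742049, 2971215073), 34444583646971231, [(31, 5, 1), (241, 24, 1), (41, 20, 1), (2161, 1080, 1), (2521, 1260, 1), (20641, 5160, 1)]),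
   (2, (64202014863723094126901777428873111802307548623680, 103881042195729914708510518382775401680142036775841, 39679027332006820581608740953902289877834488152161), 16153293957184, [(64, 1, 0), (1103, 29, 1), (47, 23, 1), (1601, 400, 1), (3041, 1520, 1)]),
   (2, (3245827735335414379438463848284780884415769460384538647704364893271223936, 12537264986760717655431063110853041918430892801204516144240573006079843137, 9291437251425303275992599262568261034015123340819977496536208112808619201), 687997255808, [(128, 1, 0), (769, 384, 1), (2207, 1103, 1), (3167, 1583, 1)]),
   (2, (14084820504325068777963134839746284974533093692892717044541373293118555392, 6919563066881356637261331122589840859560469843664463043498207290499399297, 9499834187146083559795978427362845580211765829280266717725415226929045889), 799286509312, [(256, 1, 0), (641, 64, 1), (1087, 543, 1), (4481, 560, 1)]),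
   (2, (15952776468269553290738775237033848318790606264107331102332087296807150080, 15427419754957668851571326304908103727761340913973496992207115133784569089, 16139734911277911261330333212393545104155124328374686608643609066525620993), 24904192, [(512, 1, 0), (127, 7, 1), (383, 191, 1)]),
   (2, (13608099689012992084093908742241982979859361530485653998240699522239386624, 7053263224825654604708700907037401019005805609029023715194308179559090689, 10110255160402458221112574309314707734330833757051890435722189886867906049), 41944064, [(1024, 1, 0), (40961, 10240, 1)]),
   (2, (0, 6209620913129204973416499025146691500137329888545596224797362871150001153, 6209620913129204973416499025146691500137329888545596224797362871150001153), 118698768594944, [(2048, 1, 0), (1689601, 38400, 1), (34303, 5717, 1)])]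

theorem valid_stages : valid modulus stages 1 = true := by decide +kernel

theorem chk_stages : chk modulus stages (0, 1) (0, 1) (0, 1) = true := by decide +kernel

end FibPow

/-- If positive integers `n1 ≥ n2 ≥ n3 ≥ n4` and `a` satisfy
`F_{n1} + F_{n2} + F_{n3} + F_{n4} = 2^a` with `n1 > 350` and `n1 − n2 = 2`,
then `n1 − n3 < 296`. -/
theorem special_case_n1_sub_n2_eq_two
    (n1 n2 n3 n4 a : ℕ) (hn4 : 0 < n4) (ha : 0 < a) (hn1 : 350 < n1)
    (h12 : n2 ≤ n1) (h23 : n3 ≤ n2) (h34 : n4 ≤ n3) (hdiff : n1 - n2 = 2)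
    (h : Nat.fib n1 + Nat.fib n2 + Nat.fib n3 + Nat.fib n4 = 2 ^ a) :
    n1 - n3 < 296 := by
  exfalso
  obtain rfl : n1 = n2 + 2 := by omega
  have ha' : 11 ≤ a := by
    by_contra hlt
    have h1 : 2 ^ a ≤ 2 ^ 10 := Nat.pow_le_pow_right (by norm_num) (by omega)
    have h2 : Nat.fib 17 ≤ Nat.fib (n2 + 2) := Nat.fib_mono (by omega)
    have h3 : Nat.fib 17 = 1597 := by decide +kernel
    norm_num at h1
    omega
  refine FibPow.sound FibPow.modulus n2 n3 n4 a (by decide +kernel) ha' h FibPow.stages 1 one_pos FibPow.valid_stages ?_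
  simp only [Nat.mod_one]
  have e0 : Nat.fib 0 % FibPow.modulus = 0 := by decide +kernel
  have e1 : Nat.fib (0 + 1) % FibPow.modulus = 1 := by decide +kernel
  rw [e0, e1]
  exact FibPow.chk_stages
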